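/- Let Ẽ = VᵀAV, let H̃ be an invertible r×r real matrix, let P̄_D = I − A V H̃⁻¹ Vᵀ, and set ρ = Ẽ H̃⁻¹ − I. Then every real eigenvalue μ of P̄_D A satisfies −ξ_D ≤ μ ≤ λ_max(Λ_⊥) + ξ_D, where ξ_D = ‖ρ‖₂ ‖Λ‖₂. -/

import Mathlib

open Matrix

/-- The Euclidean (2-)norm of a vector in `ℝ^k`. -/
noncomputable def euclNorm {k : ℕ} (x : Fin k → ℝ) : ℝ := Real.sqrt (∑ i, x i ^ 2)

/-- The largest singular value of a real matrix:
`σ_max(M) = max_{‖x‖₂ = 1} ‖M x‖₂`.  For a square matrix this is the spectral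
norm `‖M‖₂`. -/
noncomputable def sigmaMax {m k : ℕ} (M : Matrix (Fin m) (Fin k) ℝ) : ℝ :=
  sSup {c : ℝ | ∃ x : Fin k → ℝ, euclNorm x = 1 ∧ c = euclNorm (M.mulVec x)}

/-- The smallest singular value of a real matrix:
`σ_min(M) = min_{‖x‖₂ = 1} ‖M x‖₂`. -/
noncomputable def sigmaMin {m k : ℕ} (M : Matrix (Fin m) (Fin k) ℝ) : ℝ :=
  sInf {c : ℝ | ∃ x : Fin k → ℝ, euclNorm x = 1 ∧ c = euclNorm (M.mulVec x)}

theorem euclNorm_eq_norm_toLp {k : ℕ} (x : Fin k → ℝ) : euclNorm x = ‖WithLp.toLp 2 x‖ := by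
  simp [euclNorm, EuclideanSpace.norm_eq]

theorem euclNorm_nonneg {k : ℕ} (x : Fin k → ℝ) : 0 ≤ euclNorm x :=
  Real.sqrt_nonneg _

theorem euclNorm_smul {k : ℕ} (c : ℝ) (x : Fin k → ℝ) : euclNorm (c • x) = |c| * euclNorm x := by
  simp only [euclNorm_eq_norm_toLp, WithLp.toLp_smul, norm_smul, Real.norm_eq_abs]

theorem euclNorm_pos {k : ℕ} {x : Fin k → ℝ} (hx : x ≠ 0) : 0 < euclNorm x := by
  rw [euclNorm_eq_norm_toLp, norm_pos_iff]
  simpa using hx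

theorem sigmaMax_nonneg {m k : ℕ} (M : Matrix (Fin m) (Fin k) ℝ) : 0 ≤ sigmaMax M := by
  apply Real.sSup_nonneg
  rintro c ⟨x, -, rfl⟩
  exact euclNorm_nonneg _

open scoped Matrix.Norms.L2Operator in
theorem bddAbove_euclNorm_mulVec {m k : ℕ} (M : Matrix (Fin m) (Fin k) ℝ) :
    BddAbove {c : ℝ | ∃ x : Fin k → ℝ, euclNorm x = 1 ∧ c = euclNorm (M.mulVec x)} := by
  refine ⟨‖M‖, ?_⟩
  rintro c ⟨x, hx, rfl⟩
  have h := Matrix.l2_opNorm_mulVec M (WithLp.toLp 2 x)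
  rw [← euclNorm_eq_norm_toLp x, hx, mul_one] at h
  rw [euclNorm_eq_norm_toLp]
  exact h

theorem euclNorm_mulVec_le {m k : ℕ} (M : Matrix (Fin m) (Fin k) ℝ) (x : Fin k → ℝ) :
    euclNorm (M.mulVec x) ≤ sigmaMax M * euclNorm x := by
  rcases eq_or_ne x 0 with rfl | hx
  · simp [euclNorm]
  have hpos := euclNorm_pos hx
  have h : euclNorm (M.mulVec ((euclNorm x)⁻¹ • x)) ≤ sigmaMax M := by
    refine le_csSup (bddAbove_euclNorm_mulVec M) ⟨_, ?_, rfl⟩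
    rw [euclNorm_smul, abs_of_pos (inv_pos.2 hpos), inv_mul_cancel₀ hpos.ne']
  rw [Matrix.mulVec_smul, euclNorm_smul, abs_of_pos (inv_pos.2 hpos)] at h
  rwa [inv_mul_le_iff₀ hpos, mul_comm] at h

/-- An eigenvalue of a product is bounded by the product of the largest singular values. -/
theorem abs_le_sigmaMax_mul_sigmaMax {k : ℕ} {M N : Matrix (Fin k) (Fin k) ℝ} {c : ℝ}
    {y : Fin k → ℝ} (hy : y ≠ 0) (h : (M * N).mulVec y = c • y) :
    |c| ≤ sigmaMax M * sigmaMax N := by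
  refine le_of_mul_le_mul_right ?_ (euclNorm_pos hy)
  rw [← euclNorm_smul, ← h, ← Matrix.mulVec_mulVec, mul_assoc]
  exact (euclNorm_mulVec_le M _).trans
    (mul_le_mul_of_nonneg_left (euclNorm_mulVec_le N y) (sigmaMax_nonneg M))

/-- `A` is an `n × n` real SPD matrix (`n = r + s`) with eigenvalues
`lam i` and orthonormal eigenvectors the columns of the orthogonal matrix `U`; `V` is
the first `r` columns, `Vp` the remaining columns, `Λ = diag(λ₁,…,λ_r)`,
`Λ_⊥ = diag(λ_{r+1},…,λ_n)`.  Let `Ẽ = Vᵀ A V`, let `H̃` be an invertible `r × r`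
matrix, `P̄_D = I − A V H̃⁻¹ Vᵀ` and `ρ = Ẽ H̃⁻¹ − I`.  Then every real eigenvalue `μ`
of `P̄_D A` satisfies `−ξ_D ≤ μ ≤ λ_max(Λ_⊥) + ξ_D` with `ξ_D = ‖ρ‖₂ ‖Λ‖₂`. -/
theorem stmt_15 (r s : ℕ) (hr : 0 < r) (hs : 0 < s)
    (A : Matrix (Fin (r + s)) (Fin (r + s)) ℝ) (hA : A.PosDef)
    (lam : Fin (r + s) → ℝ) (U : Matrix (Fin (r + s)) (Fin (r + s)) ℝ)
    (hU : Uᵀ * U = 1) (hAU : A * U = U * Matrix.diagonal lam)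
    (V : Matrix (Fin (r + s)) (Fin r) ℝ) (hV : V = U.submatrix id (Fin.castAdd s))
    (Lam : Matrix (Fin r) (Fin r) ℝ)
    (hLam : Lam = Matrix.diagonal fun i => lam (Fin.castAdd s i))
    (Et : Matrix (Fin r) (Fin r) ℝ) (hEt : Et = Vᵀ * A * V)
    (H : Matrix (Fin r) (Fin r) ℝ) (hH : IsUnit H.det)
    (P : Matrix (Fin (r + s)) (Fin (r + s)) ℝ) (hP : P = 1 - A * V * H⁻¹ * Vᵀ)
    (ρ : Matrix (Fin r) (Fin r) ℝ) (hρ : ρ = Et * H⁻¹ - 1)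
    (lamMaxPerp : ℝ) (hlamMaxPerp : lamMaxPerp = ⨆ i : Fin s, lam (Fin.natAdd r i))
    (ξD : ℝ) (hξD : ξD = sigmaMax ρ * sigmaMax Lam) :
    ∀ μ ∈ spectrum ℝ (P * A), -ξD ≤ μ ∧ μ ≤ lamMaxPerp + ξD := by
  intro μ hμ
  have hξ : 0 ≤ ξD := hξD ▸ mul_nonneg (sigmaMax_nonneg _) (sigmaMax_nonneg _)
  have hAt : Aᵀ = A := by simpa using hA.isHermitian.eq
  have hUA : Uᵀ * A = Matrix.diagonal lam * Uᵀ := by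
    simpa [hAt] using congrArg Matrix.transpose hAU
  have hlam : ∀ i, 0 ≤ lam i := by
    intro i
    have h := (hA.posSemidef.conjTranspose_mul_mul_same U).diag_nonneg (i := i)
    simpa [Matrix.conjTranspose_eq_transpose_of_trivial, hUA, Matrix.mul_assoc, hU] using h
  have hle : ∀ j : Fin s, lam (Fin.natAdd r j) ≤ lamMaxPerp := fun j => by
    rw [hlamMaxPerp]
    exact le_ciSup (f := fun i : Fin s => lam (Fin.natAdd r i)) (Set.finite_range _).bddAbove j
  have hperp : 0 ≤ lamMaxPerp := (hlam _).trans (hle ⟨0, hs⟩)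
  have hVA : Vᵀ * A = Lam * Vᵀ := by
    ext i j
    have h := congrFun (congrFun hUA (Fin.castAdd s i)) j
    rw [Matrix.diagonal_mul] at h
    rw [hLam, Matrix.diagonal_mul, hV]
    simpa [Matrix.mul_apply] using h
  have hVV : Vᵀ * V = 1 := by
    ext i j
    have h := congrFun (congrFun hU (Fin.castAdd s i)) (Fin.castAdd s j)
    rw [hV]
    simpa [Matrix.mul_apply, Matrix.one_apply] using h
  have hEtLam : Et = Lam := by rw [hEt, hVA, Matrix.mul_assoc, hVV, Matrix.mul_one]
  have hPA : P * A = A - A * V * H⁻¹ * Lam * Vᵀ := by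
    rw [hP, Matrix.sub_mul, Matrix.one_mul, Matrix.mul_assoc _ Vᵀ A, hVA, ← Matrix.mul_assoc]
  have hVPA : Vᵀ * (P * A) = -(ρ * Lam) * Vᵀ := by
    have h : Vᵀ * (A * V * H⁻¹ * Lam * Vᵀ) = Lam * H⁻¹ * Lam * Vᵀ := by
      simp only [← Matrix.mul_assoc]
      rw [hVA, Matrix.mul_assoc Lam, hVV, Matrix.mul_one]
    rw [hPA, Matrix.mul_sub, h, hVA, hρ, hEtLam]
    simp only [Matrix.sub_mul, Matrix.one_mul, neg_sub]
  rw [← Matrix.spectrum_toLin', ← Module.End.hasEigenvalue_iff_mem_spectrum] at hμ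
  obtain ⟨x, hx⟩ := hμ.exists_hasEigenvector
  have hx0 : x ≠ 0 := hx.2
  have hxe : (P * A).mulVec x = μ • x := by simpa using hx.apply_eq_smul
  by_cases hy : Vᵀ.mulVec x = 0
  · have hAx : A.mulVec x = μ • x := by
      rw [← hxe, hPA, Matrix.sub_mulVec, ← Matrix.mulVec_mulVec x _ Vᵀ, hy, Matrix.mulVec_zero,
        sub_zero]
    have hz0 : Uᵀ.mulVec x ≠ 0 := by
      intro h
      apply hx0
      rw [← Matrix.one_mulVec x, ← mul_eq_one_comm.1 hU, ← Matrix.mulVec_mulVec, h,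
        Matrix.mulVec_zero]
    obtain ⟨i, hi⟩ := Function.ne_iff.1 hz0
    have hiμ : lam i = μ := by
      have h : (Uᵀ * A).mulVec x i = μ * Uᵀ.mulVec x i := by
        rw [← Matrix.mulVec_mulVec, hAx, Matrix.mulVec_smul]
        rfl
      rw [hUA, ← Matrix.mulVec_mulVec, Matrix.mulVec_diagonal] at h
      exact mul_right_cancel₀ hi h
    subst hiμ
    refine ⟨by linarith [hlam i], ?_⟩
    induction i using Fin.addCases with
    | left i =>
      refine absurd ?_ hi
      have h := congrFun hy i
      rw [hV] at h
      exact h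
    | right j => linarith [hle j]
  · have hyμ : (ρ * Lam).mulVec (Vᵀ.mulVec x) = (-μ) • Vᵀ.mulVec x := by
      have h := congrArg (Vᵀ.mulVec) hxe
      rw [Matrix.mulVec_mulVec, hVPA, ← Matrix.mulVec_mulVec, Matrix.neg_mulVec,
        Matrix.mulVec_smul] at h
      rw [neg_smul, ← h, neg_neg]
    have h := abs_le_sigmaMax_mul_sigmaMax hy hyμ
    rw [abs_neg, ← hξD, abs_le] at h
    exact ⟨h.1, by linarith [h.2]⟩
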